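/- arXiv:math/0512657 — 3 statements merged into one kernel-verified Lean document; each statement's English description precedes it below -/
import Mathlib

section
/- Fix n ≥ 3 and let F be the field of rational functions over ℚ in the indeterminates c₁, c₂, x_1, …, x_n, x̄_{n−1}, …, x̄_1. For c ∈ {c₁, c₂, c₁c₂} define maps on (2n−1)-tuples of elements of F: E_1^c replaces x_1 by x_1(c·x_1x̄_1 + x_2x̄_2)/(x_1x̄_1 + x_2x̄_2) and x̄_1 by x̄_1·c(x_1x̄_1 + x_2x̄_2)/(c·x_1x̄_1 + x_2x̄_2), fixing all other coordinates; E_0^c replaces x_1 by x_1(c·x_1x̄_1 + x_2x̄_2)/(c(x_1x̄_1 + x_2x̄_2)), x̄_1 by x̄_1(x_1x̄_1 + x_2x̄_2)/(c·x_1x̄_1 + x_2x̄_2), x_i by x_i/c for 2 ≤ i ≤ n, and x̄_i by x̄_i/c for 2 ≤ i ≤ n−1. Then, applied to the tuple of indeterminates x: E_0^{c₁}(E_1^{c₂}(x)) = E_1^{c₂}(E_0^{c₁}(x)), and both equal the tuple with x_1 replaced by x_1(c₁c₂x_1x̄_1 + x_2x̄_2)/(c₁(x_1x̄_1 + x_2x̄_2)),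 x̄_1 replaced by x̄_1·c₂(x_1x̄_1 + x_2x̄_2)/(c₁c₂x_1x̄_1 + x_2x̄_2), x_i replaced by x_i/c₁ (2 ≤ i ≤ n) and x̄_i replaced by x̄_i/c₁ (2 ≤ i ≤ n−1). Moreover, for γ_0(x) = 1/(x_2x̄_2) and γ_1(x) = (x_1x̄_1)²/(x_2x̄_2): γ_0(E_1^{c}(x)) = γ_0(x) and γ_1(E_0^{c}(x)) = γ_1(x). -/
noncomputable section

/-- The index set of the `2n+1` indeterminates `c₁, c₂, x_1, …, x_n, x̄_1, …, x̄_{n-1}`. -/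
abbrev Vars8 (n : ℕ) : Type := Fin 2 ⊕ Fin n ⊕ Fin (n - 1)

/-- The field of rational functions over `ℚ` in the indeterminates
`c₁, c₂, x_1, …, x_n, x̄_{n-1}, …, x̄_1`. -/
abbrev F8 (n : ℕ) : Type := FractionRing (MvPolynomial (Vars8 n) ℚ)

/-- A polynomial that does not vanish at `(1, …, 1)` is nonzero as a rational function. -/
theorem algebraMap_ne_zero_of_eval_one_ne_zero {σ : Type*} (p : MvPolynomial σ ℚ)
    (hp : MvPolynomial.eval 1 p ≠ 0) :
    algebraMap (MvPolynomial σ ℚ) (FractionRing (MvPolynomial σ ℚ)) p ≠ 0 := by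
  rw [Ne, FaithfulSMul.algebraMap_eq_zero_iff]
  rintro rfl
  exact hp (map_zero _)

theorem mul_div_mul_mul_div_cancel {K : Type*} [Field K] (y z c : K) {u v : K}
    (hu : u ≠ 0) (hv : v ≠ 0) : y * u / (c * v) * (z * v / u) = y * z / c := by
  field_simp

theorem mul_div_mul_mul_mul_div_cancel {K : Type*} [Field K] (y z c : K) {u v : K}
    (hu : u ≠ 0) (hv : v ≠ 0) : y * u / v * (z * (c * v) / u) = c * (y * z) := by
  field_simp

/-- On `V(B_n^{(1)})` the actions `e_0^{c₁}` and `e_1^{c₂}` commute (the nodes 0 and 1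
of the `B_n^{(1)}` Dynkin diagram are not joined), both compositions are given by the
stated explicit tuple, and `γ₀ ∘ E_1^c = γ₀`, `γ₁ ∘ E_0^c = γ₁` for
`c ∈ {c₁, c₂, c₁c₂}`. -/
theorem stmt8 (n : ℕ) (hn : 3 ≤ n)
    (c1 c2 : F8 n)
    (hc1 : c1 = algebraMap (MvPolynomial (Vars8 n) ℚ) (F8 n) (MvPolynomial.X (Sum.inl 0)))
    (hc2 : c2 = algebraMap (MvPolynomial (Vars8 n) ℚ) (F8 n) (MvPolynomial.X (Sum.inl 1)))
    (x xb : ℕ → F8 n)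
    (hx : ∀ i (h1 : 1 ≤ i) (h2 : i ≤ n),
      x i = algebraMap (MvPolynomial (Vars8 n) ℚ) (F8 n)
        (MvPolynomial.X (Sum.inr (Sum.inl ⟨i - 1, by omega⟩))))
    (hxb : ∀ i (h1 : 1 ≤ i) (h2 : i ≤ n - 1),
      xb i = algebraMap (MvPolynomial (Vars8 n) ℚ) (F8 n)
        (MvPolynomial.X (Sum.inr (Sum.inr ⟨i - 1, by omega⟩))))
    (E0 E1 : F8 n → (ℕ → F8 n) × (ℕ → F8 n) → (ℕ → F8 n) × (ℕ → F8 n))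
    (hE1 : ∀ c, c = c1 ∨ c = c2 ∨ c = c1 * c2 → ∀ p : (ℕ → F8 n) × (ℕ → F8 n),
      (E1 c p).1 1 = p.1 1 * (c * (p.1 1 * p.2 1) + p.1 2 * p.2 2)
          / (p.1 1 * p.2 1 + p.1 2 * p.2 2) ∧
      (E1 c p).2 1 = p.2 1 * (c * (p.1 1 * p.2 1 + p.1 2 * p.2 2))
          / (c * (p.1 1 * p.2 1) + p.1 2 * p.2 2) ∧
      (∀ j, j ≠ 1 → (E1 c p).1 j = p.1 j ∧ (E1 c p).2 j = p.2 j))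
    (hE0 : ∀ c, c = c1 ∨ c = c2 ∨ c = c1 * c2 → ∀ p : (ℕ → F8 n) × (ℕ → F8 n),
      (E0 c p).1 1 = p.1 1 * (c * (p.1 1 * p.2 1) + p.1 2 * p.2 2)
          / (c * (p.1 1 * p.2 1 + p.1 2 * p.2 2)) ∧
      (E0 c p).2 1 = p.2 1 * (p.1 1 * p.2 1 + p.1 2 * p.2 2)
          / (c * (p.1 1 * p.2 1) + p.1 2 * p.2 2) ∧
      (∀ j, 2 ≤ j → j ≤ n → (E0 c p).1 j = p.1 j / c) ∧
      (∀ j, 2 ≤ j → j ≤ n - 1 → (E0 c p).2 j = p.2 j / c)) :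
    (∀ j, 1 ≤ j → j ≤ n →
      (E0 c1 (E1 c2 (x, xb))).1 j = (E1 c2 (E0 c1 (x, xb))).1 j) ∧
    (∀ j, 1 ≤ j → j ≤ n - 1 →
      (E0 c1 (E1 c2 (x, xb))).2 j = (E1 c2 (E0 c1 (x, xb))).2 j) ∧
    (E0 c1 (E1 c2 (x, xb))).1 1
      = x 1 * (c1 * c2 * (x 1 * xb 1) + x 2 * xb 2) / (c1 * (x 1 * xb 1 + x 2 * xb 2)) ∧
    (E0 c1 (E1 c2 (x, xb))).2 1
      = xb 1 * (c2 * (x 1 * xb 1 + x 2 * xb 2)) / (c1 * c2 * (x 1 * xb 1) + x 2 * xb 2) ∧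
    (∀ j, 2 ≤ j → j ≤ n → (E0 c1 (E1 c2 (x, xb))).1 j = x j / c1) ∧
    (∀ j, 2 ≤ j → j ≤ n - 1 → (E0 c1 (E1 c2 (x, xb))).2 j = xb j / c1) ∧
    (∀ c, c = c1 ∨ c = c2 ∨ c = c1 * c2 →
      1 / ((E1 c (x, xb)).1 2 * (E1 c (x, xb)).2 2) = 1 / (x 2 * xb 2) ∧
      ((E0 c (x, xb)).1 1 * (E0 c (x, xb)).2 1) ^ 2
          / ((E0 c (x, xb)).1 2 * (E0 c (x, xb)).2 2)
        = (x 1 * xb 1) ^ 2 / (x 2 * xb 2)) := by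
  have hc1_ne : c1 ≠ 0 := by
    rw [hc1]
    exact algebraMap_ne_zero_of_eval_one_ne_zero _ (by simp)
  have hc2_ne : c2 ≠ 0 := by
    rw [hc2]
    exact algebraMap_ne_zero_of_eval_one_ne_zero _ (by simp)
  have hx1 := hx 1 le_rfl (by omega)
  have hx2 := hx 2 (by omega) (by omega)
  have hy1 := hxb 1 le_rfl (by omega)
  have hy2 := hxb 2 (by omega) (by omega)
  have hs : x 1 * xb 1 + x 2 * xb 2 ≠ 0 := by
    rw [hx1, hx2, hy1, hy2]
    simp only [← map_mul, ← map_add]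
    exact algebraMap_ne_zero_of_eval_one_ne_zero _ (by simp)
  have hsc : ∀ c, c = c1 ∨ c = c2 ∨ c = c1 * c2 →
      c ≠ 0 ∧ c * (x 1 * xb 1) + x 2 * xb 2 ≠ 0 := by
    rintro c (rfl | rfl | rfl) <;> refine ⟨by simp [*], ?_⟩ <;>
    · simp only [hc1, hc2, hx1, hx2, hy1, hy2, ← map_mul, ← map_add]
      exact algebraMap_ne_zero_of_eval_one_ne_zero _ (by simp)
  clear hc1 hc2 hx hxb hx1 hx2 hy1 hy2
  have hs1 := (hsc c1 (by simp)).2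
  have hs2 := (hsc c2 (by simp)).2
  have hs12 := (hsc (c1 * c2) (by simp)).2
  obtain ⟨a1, a2, a3⟩ := hE1 c2 (by simp) (x, xb)
  obtain ⟨b1, b2, b3, b4⟩ := hE0 c1 (by simp) (E1 c2 (x, xb))
  obtain ⟨d1, d2, d3, d4⟩ := hE0 c1 (by simp) (x, xb)
  obtain ⟨e1, e2, e3⟩ := hE1 c2 (by simp) (E0 c1 (x, xb))
  rw [a1, a2, (a3 2 (by norm_num)).1, (a3 2 (by norm_num)).2] at b1 b2
  rw [d1, d2, d3 2 (by omega) (by omega), d4 2 (by omega) (by omega)] at e1 e2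
  dsimp only at a1 a2 a3 b1 b2 d1 d2 d3 d4 e1 e2
  generalize hA : x 1 * xb 1 = A at *
  generalize hB : x 2 * xb 2 = B at *
  have hE1_prod : x 1 * (c2 * A + B) / (A + B) * (xb 1 * (c2 * (A + B)) / (c2 * A + B))
      = c2 * A := by
    rw [mul_div_mul_mul_mul_div_cancel _ _ _ hs2 hs, hA]
  have hE0_prod : x 1 * (c1 * A + B) / (c1 * (A + B)) * (xb 1 * (A + B) / (c1 * A + B))
      = A / c1 := by
    rw [mul_div_mul_mul_div_cancel _ _ _ hs1 hs, hA]
  have hB_div : x 2 / c1 * (xb 2 / c1) = B / c1 ^ 2 := by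
    rw [← hB]
    field_simp
  rw [hE1_prod, ← mul_assoc c1 c2 A] at b1 b2
  rw [hE0_prod, hB_div] at e1 e2
  have hden : A / c1 + B / c1 ^ 2 = (c1 * A + B) / c1 ^ 2 := by field_simp
  have hnum : c2 * (A / c1) + B / c1 ^ 2 = (c1 * c2 * A + B) / c1 ^ 2 := by field_simp
  rw [hden, hnum] at e1 e2
  have f1 : (E0 c1 (E1 c2 (x, xb))).1 1 = x 1 * (c1 * c2 * A + B) / (c1 * (A + B)) := by
    rw [b1]
    field_simp
  have f2 : (E0 c1 (E1 c2 (x, xb))).2 1 = xb 1 * (c2 * (A + B)) / (c1 * c2 * A + B) := by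
    rw [b2]
    field_simp
  have g1 : (E1 c2 (E0 c1 (x, xb))).1 1 = x 1 * (c1 * c2 * A + B) / (c1 * (A + B)) := by
    rw [e1]
    field_simp
  have g2 : (E1 c2 (E0 c1 (x, xb))).2 1 = xb 1 * (c2 * (A + B)) / (c1 * c2 * A + B) := by
    rw [e2]
    generalize c1 * A + B = s at hs1 ⊢
    generalize c1 * c2 * A + B = t at hs12 ⊢
    field_simp
  have f3 : ∀ j, 2 ≤ j → j ≤ n → (E0 c1 (E1 c2 (x, xb))).1 j = x j / c1 := fun j h h' => by
    rw [b3 j h h', (a3 j (by omega)).1]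
  have f4 : ∀ j, 2 ≤ j → j ≤ n - 1 → (E0 c1 (E1 c2 (x, xb))).2 j = xb j / c1 :=
    fun j h h' => by rw [b4 j h h', (a3 j (by omega)).2]
  refine ⟨fun j h h' => ?_, fun j h h' => ?_, f1, f2, f3, f4, fun c hc => ⟨?_, ?_⟩⟩
  · rcases h.eq_or_lt with rfl | h
    · rw [f1, g1]
    · rw [f3 j h h', (e3 j (by omega)).1, d3 j h h']
  · rcases h.eq_or_lt with rfl | h
    · rw [f2, g2]
    · rw [f4 j h h', (e3 j (by omega)).2, d4 j h h']
  · obtain ⟨-, -, h⟩ := hE1 c hc (x, xb)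
    rw [(h 2 (by norm_num)).1, (h 2 (by norm_num)).2, hB]
  · obtain ⟨h1, h2, h3, h4⟩ := hE0 c hc (x, xb)
    obtain ⟨hc0, hsc0⟩ := hsc c hc
    rw [h1, h2, h3 2 (by omega) (by omega), h4 2 (by omega) (by omega)]
    dsimp only
    have hprod : x 1 * (c * A + B) / (c * (A + B)) * (xb 1 * (A + B) / (c * A + B))
        = A / c := by
      rw [mul_div_mul_mul_div_cancel _ _ _ hsc0 hs, hA]
    have hdiv : x 2 / c * (xb 2 / c) = B / c ^ 2 := by
      rw [← hB]
      field_simp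
    rw [hA, hB, hprod, hdiv, div_pow, div_div_div_cancel_right₀ (pow_ne_zero 2 hc0)]
end
end

section
/- Fix n ≥ 2 and let F be the field of rational functions over ℚ in the indeterminates c₁, c₂, x_0, x_1, …, x_n, x̄_{n−1}, …, x̄_1. For c ∈ {c₁, c₂} define maps on 2n-tuples of elements of F: E_0^c replaces x_0 by x_0(c·x_0 + x_1x̄_1)²/(c(x_0 + x_1x̄_1)²), x_n by x_n(c·x_0 + x_1x̄_1)²/(c²(x_0 + x_1x̄_1)²), and each of x_i (1 ≤ i ≤ n−1) and x̄_i (1 ≤ i ≤ n−1) by its multiple by (c·x_0 + x_1x̄_1)/(c(x_0 + x_1x̄_1)); E_n^c replaces x_n by c·x_n, fixing all other coordinates. Define ε_0(x) = (1/x_0)(1 + x_1x̄_1/x_0)² and ε_n(x) = x_{n−1}²/x_n. Then, applied to the tuple of indeterminates x: E_0^{c₁}(E_n^{c₂}(x)) = E_n^{c₂}(E_0^{c₁}(x)), ε_0(E_n^{c}(x)) = ε_0(x), and ε_n(E_0^{c}(x)) = ε_n(x). -/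
noncomputable section

/-- The index set of the `2n+2` indeterminates `c₁, c₂, x_0, …, x_n, x̄_1, …, x̄_{n-1}`. -/
abbrev Vars9 (n : ℕ) : Type := Fin 2 ⊕ Fin (n + 1) ⊕ Fin (n - 1)

/-- The field of rational functions over `ℚ` in the indeterminates
`c₁, c₂, x_0, x_1, …, x_n, x̄_{n-1}, …, x̄_1`. -/
abbrev F9 (n : ℕ) : Type := FractionRing (MvPolynomial (Vars9 n) ℚ)

/-- A polynomial that does not vanish at some rational point is nonzero as a rational function. -/
theorem algebraMap_ne_zero_of_eval_ne_zero {σ : Type*} (v : σ → ℚ) {p : MvPolynomial σ ℚ}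
    (hp : MvPolynomial.eval v p ≠ 0) :
    algebraMap (MvPolynomial σ ℚ) (FractionRing (MvPolynomial σ ℚ)) p ≠ 0 := by
  have h0 : p ≠ 0 := by
    rintro rfl
    exact hp (map_zero _)
  simpa using h0

/-- A ratio `a ^ 2 / b` is unchanged when `a` is scaled by `A / (c * B)` and `b` by its square. -/
theorem sq_div_eq_of_scaled {K : Type*} [Field K] {c A B : K} (a b : K)
    (hc : c ≠ 0) (hA : A ≠ 0) (hB : B ≠ 0) :
    (a * A / (c * B)) ^ 2 / (b * A ^ 2 / (c ^ 2 * B ^ 2)) = a ^ 2 / b := by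
  have hs : (A / (c * B)) ^ 2 ≠ 0 := pow_ne_zero _ (div_ne_zero hA (mul_ne_zero hc hB))
  rw [← mul_div_mul_right (a ^ 2) b hs]
  congr 1 <;> ring

/-- On `V(C_n^{(1)})` the actions `e_0^{c₁}` and `e_n^{c₂}` commute (the nodes 0 and n
of the `C_n^{(1)}` Dynkin diagram are not joined) and `ε_0 ∘ E_n^c = ε_0`,
`ε_n ∘ E_0^c = ε_n` for `c ∈ {c₁, c₂}`. -/
theorem stmt9 (n : ℕ) (hn : 2 ≤ n)
    (c1 c2 : F9 n)
    (hc1 : c1 = algebraMap (MvPolynomial (Vars9 n) ℚ) (F9 n) (MvPolynomial.X (Sum.inl 0)))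
    (hc2 : c2 = algebraMap (MvPolynomial (Vars9 n) ℚ) (F9 n) (MvPolynomial.X (Sum.inl 1)))
    (x xb : ℕ → F9 n)
    (hx : ∀ i (h : i ≤ n),
      x i = algebraMap (MvPolynomial (Vars9 n) ℚ) (F9 n)
        (MvPolynomial.X (Sum.inr (Sum.inl ⟨i, by omega⟩))))
    (hxb : ∀ i (h1 : 1 ≤ i) (h2 : i ≤ n - 1),
      xb i = algebraMap (MvPolynomial (Vars9 n) ℚ) (F9 n)
        (MvPolynomial.X (Sum.inr (Sum.inr ⟨i - 1, by omega⟩))))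
    (E0 En : F9 n → (ℕ → F9 n) × (ℕ → F9 n) → (ℕ → F9 n) × (ℕ → F9 n))
    (hE0 : ∀ c, c = c1 ∨ c = c2 → ∀ p : (ℕ → F9 n) × (ℕ → F9 n),
      (E0 c p).1 0 = p.1 0 * (c * p.1 0 + p.1 1 * p.2 1) ^ 2
          / (c * (p.1 0 + p.1 1 * p.2 1) ^ 2) ∧
      (E0 c p).1 n = p.1 n * (c * p.1 0 + p.1 1 * p.2 1) ^ 2
          / (c ^ 2 * (p.1 0 + p.1 1 * p.2 1) ^ 2) ∧
      (∀ j, 1 ≤ j → j ≤ n - 1 →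
        (E0 c p).1 j = p.1 j * (c * p.1 0 + p.1 1 * p.2 1)
            / (c * (p.1 0 + p.1 1 * p.2 1)) ∧
        (E0 c p).2 j = p.2 j * (c * p.1 0 + p.1 1 * p.2 1)
            / (c * (p.1 0 + p.1 1 * p.2 1))))
    (hEn : ∀ c, c = c1 ∨ c = c2 → ∀ p : (ℕ → F9 n) × (ℕ → F9 n),
      (En c p).1 n = c * p.1 n ∧
      (∀ j, j ≠ n → (En c p).1 j = p.1 j) ∧
      (∀ j, (En c p).2 j = p.2 j))
    (eps0 epsn : (ℕ → F9 n) × (ℕ → F9 n) → F9 n)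
    (heps0 : ∀ p : (ℕ → F9 n) × (ℕ → F9 n),
      eps0 p = (1 / p.1 0) * (1 + p.1 1 * p.2 1 / p.1 0) ^ 2)
    (hepsn : ∀ p : (ℕ → F9 n) × (ℕ → F9 n), epsn p = p.1 (n - 1) ^ 2 / p.1 n) :
    (∀ j, j ≤ n → (E0 c1 (En c2 (x, xb))).1 j = (En c2 (E0 c1 (x, xb))).1 j) ∧
    (∀ j, 1 ≤ j → j ≤ n - 1 →
      (E0 c1 (En c2 (x, xb))).2 j = (En c2 (E0 c1 (x, xb))).2 j) ∧
    (∀ c, c = c1 ∨ c = c2 →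
      eps0 (En c (x, xb)) = eps0 (x, xb) ∧ epsn (E0 c (x, xb)) = epsn (x, xb)) := by
  have h1n : (1 : ℕ) ≠ n := by omega
  have h0n : (0 : ℕ) ≠ n := by omega
  obtain ⟨hEn_n, hEn_fst, hEn_snd⟩ := hEn c2 (Or.inr rfl) (x, xb)
  obtain ⟨hEn_n', hEn_fst', hEn_snd'⟩ := hEn c2 (Or.inr rfl) (E0 c1 (x, xb))
  obtain ⟨hE0_0, hE0_n, hE0_mid⟩ := hE0 c1 (Or.inl rfl) (x, xb)
  obtain ⟨hE0_0', hE0_n', hE0_mid'⟩ := hE0 c1 (Or.inl rfl) (En c2 (x, xb))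
  refine ⟨fun j hj => ?_, fun j hj1 hj2 => ?_, fun c hc => ⟨?_, ?_⟩⟩
  · rcases eq_or_ne j n with rfl | hjn
    · rw [hE0_n', hEn_n', hE0_n, hEn_n, hEn_fst 0 h0n, hEn_fst 1 h1n, hEn_snd 1]
      ring
    · rw [hEn_fst' j hjn]
      rcases Nat.eq_zero_or_pos j with rfl | hj0
      · rw [hE0_0', hE0_0, hEn_fst 0 h0n, hEn_fst 1 h1n, hEn_snd 1]
      · rw [(hE0_mid' j hj0 (by omega)).1, (hE0_mid j hj0 (by omega)).1, hEn_fst j hjn,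
          hEn_fst 0 h0n, hEn_fst 1 h1n, hEn_snd 1]
  · rw [hEn_snd' j, (hE0_mid' j hj1 hj2).2, (hE0_mid j hj1 hj2).2, hEn_snd j,
      hEn_fst 0 h0n, hEn_fst 1 h1n, hEn_snd 1]
  · obtain ⟨-, hfst, hsnd⟩ := hEn c hc (x, xb)
    rw [heps0, heps0, hfst 0 h0n, hfst 1 h1n, hsnd 1]
  · obtain ⟨k, rfl⟩ : ∃ k, c = algebraMap (MvPolynomial (Vars9 n) ℚ) (F9 n)
        (MvPolynomial.X (Sum.inl k)) := by
      rcases hc with h | h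
      · exact ⟨0, h.trans hc1⟩
      · exact ⟨1, h.trans hc2⟩
    obtain ⟨-, hn_fst, hmid⟩ := hE0 _ hc (x, xb)
    rw [hepsn, hepsn, hn_fst, (hmid (n - 1) (by omega) le_rfl).1]
    apply sq_div_eq_of_scaled
    · exact algebraMap_ne_zero_of_eval_ne_zero (fun _ => 1) (by simp)
    · dsimp only
      rw [hx 0 (by omega), hx 1 (by omega), hxb 1 le_rfl (by omega), ← map_mul, ← map_mul,
        ← map_add]
      exact algebraMap_ne_zero_of_eval_ne_zero (fun _ => 1) (by norm_num)
    · dsimp only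
      rw [hx 0 (by omega), hx 1 (by omega), hxb 1 le_rfl (by omega), ← map_mul, ← map_add]
      exact algebraMap_ne_zero_of_eval_ne_zero (fun _ => 1) (by norm_num)
end
end

section
/- Fix n ≥ 2, let F be the field of rational functions over ℚ in the indeterminates x_0, x_1, …, x_n, x̄_{n−1}, …, x̄_1, and let σ̄(x) = (y_0, y_1, …, y_n, ȳ_{n−1}, …, ȳ_1) be given by A(x) = (x_{n−1}x̄_{n−1} + x_n)/(x_{n−1}x_n), y_0 = x_n·A(x)², y_i = A(x)(x_{n−i−1}x̄_{n−i−1} + x_{n−i}x̄_{n−i})/x_{n−i−1} (1 ≤ i ≤ n−2), y_{n−1} = A(x)(x_0 + x_1x̄_1)/x_0, y_n = x_0·A(x)², ȳ_i = A(x)·x_{n−i−1}x_{n−i}x̄_{n−i}/(x_{n−i−1}x̄_{n−i−1} + x_{n−i}x̄_{n−i}) (1 ≤ i ≤ n−2), ȳ_{n−1} = A(x)·x_0x_1x̄_1/(x_0 + x_1x̄_1). Define ε_i(z) = (z_{i−1}/z_i)(1 + z_{i+1}z̄_{i+1}/(z_iz̄_i)) for 1 ≤ i ≤ n−2 and ε_{n−1}(z)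 = (z_{n−2}/z_{n−1})(1 + z_n/(z_{n−1}z̄_{n−1})) (where z_0 is the 0-th coordinate). Then ε_{n−i}(σ̄(x)) = ε_i(x) for all 1 ≤ i ≤ n−1. -/
noncomputable section

/-- The index set of the `2n` indeterminates `x_0, x_1, …, x_n, x̄_1, …, x̄_{n-1}`. -/
abbrev Vars10 (n : ℕ) : Type := Fin (n + 1) ⊕ Fin (n - 1)

/-- The field of rational functions over `ℚ` in the indeterminates
`x_0, x_1, …, x_n, x̄_{n-1}, …, x̄_1`. -/
abbrev F10 (n : ℕ) : Type := FractionRing (MvPolynomial (Vars10 n) ℚ)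

/-- A polynomial that does not vanish at `(1, …, 1)` is nonzero in the fraction field. -/
theorem algebraMap_ne_zero_of_eval_one_ne_zero_s10 {n : ℕ} {p : MvPolynomial (Vars10 n) ℚ}
    (hp : MvPolynomial.eval (fun _ => 1) p ≠ 0) :
    algebraMap (MvPolynomial (Vars10 n) ℚ) (F10 n) p ≠ 0 := by
  intro h
  rw [FaithfulSMul.algebraMap_eq_zero_iff] at h
  exact hp (by rw [h, map_zero])

/-- The weights `z_0, z_1 z̄_1, …, z_{n-1} z̄_{n-1}, z_n` entering `σ̄` and the functions `ε_i`. -/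
def weight {K : Type*} [Mul K] (n : ℕ) (z zb : ℕ → K) (k : ℕ) : K :=
  if k = 0 ∨ k = n then z k else z k * zb k

theorem weight_zero {K : Type*} [Mul K] (n : ℕ) (z zb : ℕ → K) : weight n z zb 0 = z 0 :=
  if_pos (.inl rfl)

theorem weight_self {K : Type*} [Mul K] (n : ℕ) (z zb : ℕ → K) : weight n z zb n = z n :=
  if_pos (.inr rfl)

theorem weight_of_pos_of_lt {K : Type*} [Mul K] {n k : ℕ} (z zb : ℕ → K) (h0 : 0 < k)
    (hk : k < n) : weight n z zb k = z k * zb k :=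
  if_neg (by omega)

/-- The compatibility `ε_{σ(i)} ∘ σ̄ = ε_i` for the birational involution `σ̄` of
`V(C_n^{(1)})` and the diagram automorphism `σ : i ↦ n − i`:
`ε_{n-i}(σ̄(x)) = ε_i(x)` for all `1 ≤ i ≤ n−1`. -/
theorem stmt10 (n : ℕ) (hn : 2 ≤ n)
    (x xb : ℕ → F10 n)
    (hx : ∀ i (h : i ≤ n),
      x i = algebraMap (MvPolynomial (Vars10 n) ℚ) (F10 n)
        (MvPolynomial.X (Sum.inl ⟨i, by omega⟩)))
    (hxb : ∀ i (h1 : 1 ≤ i) (h2 : i ≤ n - 1),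
      xb i = algebraMap (MvPolynomial (Vars10 n) ℚ) (F10 n)
        (MvPolynomial.X (Sum.inr ⟨i - 1, by omega⟩)))
    (A : F10 n) (hA : A = (x (n-1) * xb (n-1) + x n) / (x (n-1) * x n))
    (y yb : ℕ → F10 n)
    (hy0 : y 0 = x n * A ^ 2)
    (hyi : ∀ i, 1 ≤ i → i ≤ n - 2 →
      y i = A * (x (n-i-1) * xb (n-i-1) + x (n-i) * xb (n-i)) / x (n-i-1))
    (hyn1 : y (n-1) = A * (x 0 + x 1 * xb 1) / x 0)
    (hyn : y n = x 0 * A ^ 2)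
    (hybi : ∀ i, 1 ≤ i → i ≤ n - 2 →
      yb i = A * (x (n-i-1) * x (n-i) * xb (n-i))
        / (x (n-i-1) * xb (n-i-1) + x (n-i) * xb (n-i)))
    (hybn1 : yb (n-1) = A * (x 0 * x 1 * xb 1) / (x 0 + x 1 * xb 1))
    (eps : ℕ → (ℕ → F10 n) → (ℕ → F10 n) → F10 n)
    (hepsi : ∀ i, 1 ≤ i → i ≤ n - 2 → ∀ z zb : ℕ → F10 n,
      eps i z zb = (z (i-1) / z i) * (1 + z (i+1) * zb (i+1) / (z i * zb i)))
    (hepsn1 : ∀ z zb : ℕ → F10 n,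
      eps (n-1) z zb = (z (n-2) / z (n-1)) * (1 + z n / (z (n-1) * zb (n-1)))) :
    ∀ i, 1 ≤ i → i ≤ n - 1 → eps (n - i) y yb = eps i x xb := by
  have exists_weight : ∀ k, k ≤ n → ∃ p : MvPolynomial (Vars10 n) ℚ,
      weight n x xb k = algebraMap _ (F10 n) p ∧ MvPolynomial.eval (fun _ => 1) p = 1 := by
    intro k hk
    by_cases h : k = 0 ∨ k = n
    · exact ⟨_, (if_pos h).trans (hx k hk), by simp⟩
    · refine ⟨MvPolynomial.X (Sum.inl ⟨k, by omega⟩) *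
        MvPolynomial.X (Sum.inr ⟨k - 1, by omega⟩),
        (weight_of_pos_of_lt x xb (by omega) (by omega)).trans ?_, ?_⟩
      · rw [hx k hk, hxb k (by omega) (by omega), map_mul]
      · simp
  have hx0 : ∀ k, k ≤ n → x k ≠ 0 := by
    intro k hk
    rw [hx k hk]
    exact algebraMap_ne_zero_of_eval_one_ne_zero_s10 (by simp)
  have hw0 : ∀ k, k ≤ n → weight n x xb k ≠ 0 := by
    intro k hk
    obtain ⟨p, hp, hp1⟩ := exists_weight k hk
    rw [hp]
    exact algebraMap_ne_zero_of_eval_one_ne_zero_s10 (by simp [hp1])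
  have hs0 : ∀ k, k < n → weight n x xb k + weight n x xb (k + 1) ≠ 0 := by
    intro k hk
    obtain ⟨p, hp, hp1⟩ := exists_weight k hk.le
    obtain ⟨q, hq, hq1⟩ := exists_weight (k + 1) hk
    rw [hp, hq, ← map_add]
    exact algebraMap_ne_zero_of_eval_one_ne_zero_s10 (by norm_num [hp1, hq1])
  have hA' : A = (weight n x xb (n - 1) + weight n x xb n) / (x (n - 1) * x n) := by
    rw [hA, weight_self, weight_of_pos_of_lt x xb (by omega) (by omega)]
  have hA0 : A ≠ 0 := by
    have := hs0 (n - 1) (by omega)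
    rw [Nat.sub_add_cancel (by omega)] at this
    rw [hA']
    exact div_ne_zero this (mul_ne_zero (hx0 _ (by omega)) (hx0 _ le_rfl))
  have hy : ∀ j k, j + k + 1 = n →
      y j = A * (weight n x xb k + weight n x xb (k + 1)) / x k := by
    intro j k hjk
    rcases Nat.eq_zero_or_pos j with rfl | hj
    · obtain rfl : k = n - 1 := by omega
      have h1 := hx0 (n - 1) (by omega)
      have h2 := hx0 n le_rfl
      rw [hy0, Nat.sub_add_cancel (by omega), pow_two]
      nth_rewrite 2 [hA']
      field_simp
    · rcases Nat.eq_zero_or_pos k with rfl | hk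
      · obtain rfl : j = n - 1 := by omega
        rw [hyn1, weight_zero, weight_of_pos_of_lt x xb (by omega) (by omega)]
      · rw [hyi j hj (by omega), weight_of_pos_of_lt x xb hk (by omega),
          weight_of_pos_of_lt x xb (by omega) (by omega), show n - j - 1 = k by omega,
          show n - j = k + 1 by omega]
  have hwy : ∀ j k, 0 < j → j + k = n → weight n y yb j = A ^ 2 * weight n x xb k := by
    intro j k hj hjk
    rcases k with _ | k
    · obtain rfl : j = n := by omega
      rw [weight_self, weight_zero, hyn, mul_comm]
    · have hxk := hx0 k (by omega)
      have hs := hs0 k (by omega)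
      have hyb : yb j = A * (x k * weight n x xb (k + 1)) /
          (weight n x xb k + weight n x xb (k + 1)) := by
        rcases Nat.eq_zero_or_pos k with rfl | hk
        · obtain rfl : j = n - 1 := by omega
          rw [hybn1, weight_zero, weight_of_pos_of_lt x xb (by omega) (by omega), mul_assoc (x 0)]
        · rw [hybi j hj (by omega), weight_of_pos_of_lt x xb hk (by omega),
            weight_of_pos_of_lt x xb (by omega) (by omega), show n - j - 1 = k by omega,
            show n - j = k + 1 by omega, mul_assoc (x k)]
      rw [weight_of_pos_of_lt y yb hj (by omega), hyb, hy j k (by omega)]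
      field_simp
  have heps : ∀ i, i + 1 < n → ∀ z zb : ℕ → F10 n, eps (i + 1) z zb =
      z i / z (i + 1) * (1 + weight n z zb (i + 2) / weight n z zb (i + 1)) := by
    intro i hi z zb
    rw [weight_of_pos_of_lt z zb (Nat.succ_pos i) hi]
    by_cases h : i + 2 = n
    · have := hepsn1 z zb
      rw [show n - 1 = i + 1 by omega, show n - 2 = i by omega] at this
      rw [h, weight_self, this]
    · rw [weight_of_pos_of_lt z zb (by omega) (by omega)]
      exact hepsi (i + 1) (by omega) (by omega) z zb
  intro i hi1 hi2
  obtain ⟨k, rfl⟩ : ∃ k, i = k + 1 := ⟨i - 1, by omega⟩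
  obtain ⟨j, hj⟩ : ∃ j, n - (k + 1) = j + 1 := ⟨n - k - 2, by omega⟩
  rw [hj, heps j (by omega), heps k (by omega), hy j (k + 1) (by omega),
    hy (j + 1) k (by omega), hwy (j + 2) k (by omega) (by omega),
    hwy (j + 1) (k + 1) (by omega) (by omega)]
  have h1 := hx0 k (by omega)
  have h2 := hx0 (k + 1) (by omega)
  have h3 := hw0 (k + 1) (by omega)
  have h4 := hs0 k (by omega)
  field_simp
  ring
end
end
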